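/- (Uniqueness of the best approximator.) Suppose θ* ∈ ℝ^m satisfies A g^{(θ*)} = A η. Then g^{(θ*)} is the unique minimizer of d(η, ·) over the exponential family 𝒢: for every θ ∈ ℝ^m, d(η, g^{(θ*)}) ≤ d(η, g^{(θ)}), and if d(η, g^{(θ)}) = d(η, g^{(θ*)}) then g^{(θ)} = g^{(θ*)} as elements of Δ_k^n. -/

import Mathlib

open Finset

attribute [local instance] Classical.propDecidable

noncomputable section

/-- The simplex `Δ_k^n`: rows are probability distributions over `Fin k`. -/
def Simplex (n k : ℕ) : Set (Fin n → Fin k → ℝ) :=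
  {z | (∀ i ℓ, 0 ≤ z i ℓ) ∧ ∀ i, ∑ ℓ, z i ℓ = 1}

/-- Number of points where rule `j` does not abstain. -/
def nRule {n k p : ℕ} (h : Fin p → Fin n → Option (Fin k)) (j : Fin p) : ℕ :=
  (Finset.univ.filter (fun i => h j i ≠ none)).card

/-- The constraint matrix `A`, with `m = p + k` rows indexed by `Fin p ⊕ Fin k`. -/
def Amat {n k p : ℕ} (h : Fin p → Fin n → Option (Fin k)) :
    Fin p ⊕ Fin k → Fin n → Fin k → ℝ
  | Sum.inl j => fun i ℓ => if h j i = some ℓ then 1 / (nRule h j : ℝ) else 0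
  | Sum.inr ℓ' => fun i ℓ => if ℓ = ℓ' then 1 / (n : ℝ) else 0

/-- `(A z)_j`. -/
def applyA {n k p : ℕ} (h : Fin p → Fin n → Option (Fin k))
    (z : Fin n → Fin k → ℝ) (j : Fin p ⊕ Fin k) : ℝ :=
  ∑ i, ∑ ℓ, Amat h j i ℓ * z i ℓ

/-- The polytope `P(b, ε)`. -/
def Polytope {n k p : ℕ} (h : Fin p → Fin n → Option (Fin k))
    (b ε : Fin p ⊕ Fin k → ℝ) : Set (Fin n → Fin k → ℝ) :=
  {z | z ∈ Simplex n k ∧ ∀ j, b j - ε j ≤ applyA h z j ∧ applyA h z j ≤ b j + ε j}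

/-- Extended-real logarithm, with `elog 0 = ⊥ = -∞`. -/
def elog (x : ℝ) : EReal := if x = 0 then ⊥ else ((Real.log x : ℝ) : EReal)

/-- `z · log g`, valued in `[-∞, 0]` with the convention `0 · log 0 = 0`. -/
def dotlog {n k : ℕ} (z g : Fin n → Fin k → ℝ) : EReal :=
  ∑ i, ∑ ℓ, (z i ℓ : EReal) * elog (g i ℓ)

/-- `a^{(θ)}_{iℓ} = Σ_j θ_j · A j i ℓ`. -/
def avec {n k p : ℕ} (h : Fin p → Fin n → Option (Fin k))
    (θ : Fin p ⊕ Fin k → ℝ) (i : Fin n) (ℓ : Fin k) : ℝ :=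
  ∑ j, θ j * Amat h j i ℓ

/-- The exponential-family (softmax) prediction `g^{(θ)}`. -/
def gexp {n k p : ℕ} (h : Fin p → Fin n → Option (Fin k))
    (θ : Fin p ⊕ Fin k → ℝ) (i : Fin n) (ℓ : Fin k) : ℝ :=
  Real.exp (avec h θ i ℓ) / ∑ ℓ', Real.exp (avec h θ i ℓ')

/-- The BF dual objective `(σ'−σ)·b − (σ'+σ)·ε − Σ_i log(Σ_ℓ exp(a^{(σ'−σ)}_{iℓ}))`. -/
def dualObj {n k p : ℕ} (h : Fin p → Fin n → Option (Fin k))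
    (b ε σ σ' : Fin p ⊕ Fin k → ℝ) : ℝ :=
  (∑ j, (σ' j - σ j) * b j) - (∑ j, (σ' j + σ j) * ε j)
    - ∑ i, Real.log (∑ ℓ, Real.exp (avec h (fun j => σ' j - σ j) i ℓ))

/-- KL summand `a·log(a/c)`, with `0·log(0/c) = 0` and `a·log(a/0) = ⊤` for `a ≠ 0`. -/
def klTerm (a c : ℝ) : EReal :=
  if a = 0 then 0 else if c = 0 then ⊤ else ((a * Real.log (a / c) : ℝ) : EReal)

/-- `d(μ, ν)`, the summed KL divergences, valued in `[0, +∞]`. -/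
def dKL {n k : ℕ} (μ ν : Fin n → Fin k → ℝ) : EReal :=
  ∑ i, ∑ ℓ, klTerm (μ i ℓ) (ν i ℓ)

/-- Unnormalized one-coin Dawid–Skene score `N_{iℓ}`. -/
def Nds {n k p : ℕ} (h : Fin p → Fin n → Option (Fin k))
    (w : Fin k → ℝ) (β : Fin p → ℝ) (i : Fin n) (ℓ : Fin k) : ℝ :=
  w ℓ * (∏ j ∈ Finset.univ.filter (fun j => h j i = some ℓ), β j)
    * ∏ j ∈ Finset.univ.filter (fun j => ∃ ℓ' ≠ ℓ, h j i = some ℓ'),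
        (1 - β j) / ((k : ℝ) - 1)

/-- The one-coin Dawid–Skene prediction `g^{ds}(w, β)`. -/
def gds {n k p : ℕ} (h : Fin p → Fin n → Option (Fin k))
    (w : Fin k → ℝ) (β : Fin p → ℝ) (i : Fin n) (ℓ : Fin k) : ℝ :=
  Nds h w β i ℓ / ∑ ℓ', Nds h w β i ℓ'

theorem sum_exp_avec_pos {n k p : ℕ} (hk : 0 < k) (h : Fin p → Fin n → Option (Fin k))
    (θ : Fin p ⊕ Fin k → ℝ) (i : Fin n) : 0 < ∑ ℓ, Real.exp (avec h θ i ℓ) :=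
  Finset.sum_pos (fun _ _ => Real.exp_pos _) ⟨⟨0, hk⟩, Finset.mem_univ _⟩

theorem gexp_pos {n k p : ℕ} (hk : 0 < k) (h : Fin p → Fin n → Option (Fin k))
    (θ : Fin p ⊕ Fin k → ℝ) (i : Fin n) (ℓ : Fin k) : 0 < gexp h θ i ℓ :=
  div_pos (Real.exp_pos _) (sum_exp_avec_pos hk h θ i)

theorem gexp_mem_Simplex {n k p : ℕ} (hk : 0 < k) (h : Fin p → Fin n → Option (Fin k))
    (θ : Fin p ⊕ Fin k → ℝ) : gexp h θ ∈ Simplex n k := by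
  refine ⟨fun i ℓ => (gexp_pos hk h θ i ℓ).le, fun i => ?_⟩
  simp only [gexp]
  rw [← Finset.sum_div, div_self (sum_exp_avec_pos hk h θ i).ne']

theorem log_gexp {n k p : ℕ} (hk : 0 < k) (h : Fin p → Fin n → Option (Fin k))
    (θ : Fin p ⊕ Fin k → ℝ) (i : Fin n) (ℓ : Fin k) :
    Real.log (gexp h θ i ℓ) = avec h θ i ℓ - Real.log (∑ ℓ', Real.exp (avec h θ i ℓ')) := by
  rw [gexp, Real.log_div (Real.exp_pos _).ne' (sum_exp_avec_pos hk h θ i).ne', Real.log_exp]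

theorem sum_mul_avec {n k p : ℕ} (h : Fin p → Fin n → Option (Fin k))
    (z : Fin n → Fin k → ℝ) (θ : Fin p ⊕ Fin k → ℝ) :
    ∑ i, ∑ ℓ, z i ℓ * avec h θ i ℓ = ∑ j, θ j * applyA h z j := by
  simp only [avec, applyA, Finset.mul_sum]
  simp_rw [Finset.sum_comm (s := (Finset.univ : Finset (Fin k)))
    (t := (Finset.univ : Finset (Fin p ⊕ Fin k)))]
  rw [Finset.sum_comm]
  exact Finset.sum_congr rfl fun j _ => Finset.sum_congr rfl fun i _ =>
    Finset.sum_congr rfl fun ℓ _ => by ring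

/-- The cross term `z · log g^{(θ)}` depends on `z` only through the moments `A z`. -/
theorem sum_mul_log_gexp {n k p : ℕ} (hk : 0 < k) (h : Fin p → Fin n → Option (Fin k))
    {z : Fin n → Fin k → ℝ} (hz : z ∈ Simplex n k) (θ : Fin p ⊕ Fin k → ℝ) :
    ∑ i, ∑ ℓ, z i ℓ * Real.log (gexp h θ i ℓ)
      = ∑ j, θ j * applyA h z j - ∑ i, Real.log (∑ ℓ, Real.exp (avec h θ i ℓ)) := by
  simp only [log_gexp hk, mul_sub, Finset.sum_sub_distrib, ← Finset.sum_mul, hz.2, one_mul,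
    sum_mul_avec]

theorem klTerm_of_pos {a c : ℝ} (hc : 0 < c) :
    klTerm a c = ((a * Real.log a - a * Real.log c : ℝ) : EReal) := by
  by_cases ha : a = 0
  · simp [klTerm, ha]
  · rw [klTerm, if_neg ha, if_neg hc.ne', Real.log_div ha hc.ne', mul_sub]

theorem EReal_coe_sum {ι : Type*} (s : Finset ι) (f : ι → ℝ) :
    ((∑ i ∈ s, f i : ℝ) : EReal) = ∑ i ∈ s, (f i : EReal) :=
  map_sum (⟨⟨Real.toEReal, EReal.coe_zero⟩, EReal.coe_add⟩ : ℝ →+ EReal) f s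

theorem dKL_of_pos {n k : ℕ} (μ : Fin n → Fin k → ℝ) {ν : Fin n → Fin k → ℝ}
    (hν : ∀ i ℓ, 0 < ν i ℓ) :
    dKL μ ν = ((∑ i, ∑ ℓ, μ i ℓ * Real.log (μ i ℓ)
      - ∑ i, ∑ ℓ, μ i ℓ * Real.log (ν i ℓ) : ℝ) : EReal) := by
  simp only [dKL, klTerm_of_pos (hν _ _), ← EReal_coe_sum, Finset.sum_sub_distrib]

/-- Gibbs' inequality in pointwise form. -/
theorem mul_log_le_mul_log_add {a c : ℝ} (ha : 0 < a) (hc : 0 < c) :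
    a * Real.log c ≤ a * Real.log a + (c - a) := by
  have h1 := mul_le_mul_of_nonneg_left (Real.log_le_sub_one_of_pos (div_pos hc ha)) ha.le
  rw [Real.log_div hc.ne' ha.ne', mul_sub, mul_sub, mul_div_cancel₀ _ ha.ne'] at h1
  linarith

theorem eq_of_mul_log_eq {a c : ℝ} (ha : 0 < a) (hc : 0 < c)
    (hac : a * Real.log c = a * Real.log a + (c - a)) : c = a := by
  by_contra hne
  have h1 := mul_lt_mul_of_pos_left
    (Real.log_lt_sub_one_of_pos (div_pos hc ha) (by rwa [Ne, div_eq_one_iff_eq ha.ne'])) ha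
  rw [Real.log_div hc.ne' ha.ne', mul_sub, mul_sub, mul_div_cancel₀ _ ha.ne'] at h1
  linarith

theorem sum_mul_log_add_sub {n k : ℕ} {μ ν : Fin n → Fin k → ℝ}
    (hμ : μ ∈ Simplex n k) (hν : ν ∈ Simplex n k) :
    ∑ i, ∑ ℓ, (μ i ℓ * Real.log (μ i ℓ) + (ν i ℓ - μ i ℓ))
      = ∑ i, ∑ ℓ, μ i ℓ * Real.log (μ i ℓ) := by
  simp only [Finset.sum_add_distrib, Finset.sum_sub_distrib, hμ.2, hν.2, sub_self, add_zero]

theorem sum_mul_log_le {n k : ℕ} {μ ν : Fin n → Fin k → ℝ}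
    (hμ : μ ∈ Simplex n k) (hν : ν ∈ Simplex n k)
    (hμ0 : ∀ i ℓ, 0 < μ i ℓ) (hν0 : ∀ i ℓ, 0 < ν i ℓ) :
    ∑ i, ∑ ℓ, μ i ℓ * Real.log (ν i ℓ) ≤ ∑ i, ∑ ℓ, μ i ℓ * Real.log (μ i ℓ) := by
  rw [← sum_mul_log_add_sub hμ hν]
  exact Finset.sum_le_sum fun i _ => Finset.sum_le_sum fun ℓ _ =>
    mul_log_le_mul_log_add (hμ0 i ℓ) (hν0 i ℓ)

theorem eq_of_sum_mul_log_eq {n k : ℕ} {μ ν : Fin n → Fin k → ℝ}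
    (hμ : μ ∈ Simplex n k) (hν : ν ∈ Simplex n k)
    (hμ0 : ∀ i ℓ, 0 < μ i ℓ) (hν0 : ∀ i ℓ, 0 < ν i ℓ)
    (heq : ∑ i, ∑ ℓ, μ i ℓ * Real.log (ν i ℓ) = ∑ i, ∑ ℓ, μ i ℓ * Real.log (μ i ℓ)) :
    ν = μ := by
  have hle : ∀ i ℓ, μ i ℓ * Real.log (ν i ℓ)
      ≤ μ i ℓ * Real.log (μ i ℓ) + (ν i ℓ - μ i ℓ) :=
    fun i ℓ => mul_log_le_mul_log_add (hμ0 i ℓ) (hν0 i ℓ)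
  rw [← sum_mul_log_add_sub hμ hν,
    Finset.sum_eq_sum_iff_of_le fun i _ => Finset.sum_le_sum fun ℓ _ => hle i ℓ] at heq
  funext i ℓ
  have hi := heq i (Finset.mem_univ i)
  rw [Finset.sum_eq_sum_iff_of_le fun ℓ _ => hle i ℓ] at hi
  exact eq_of_mul_log_eq (hμ0 i ℓ) (hν0 i ℓ) (hi ℓ (Finset.mem_univ ℓ))

/-- uniqueness of the best approximator in the exponential family. -/
theorem stmt5 {n k p : ℕ} (hn : 0 < n) (hk : 2 ≤ k) (hp : 0 < p)
    (h : Fin p → Fin n → Option (Fin k)) (hnj : ∀ j, 0 < nRule h j)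
    (η : Fin n → Fin k → ℝ) (hη : η ∈ Simplex n k)
    (θstar : Fin p ⊕ Fin k → ℝ)
    (hmatch : ∀ j, applyA h (gexp h θstar) j = applyA h η j) :
    ∀ θ : Fin p ⊕ Fin k → ℝ,
      dKL η (gexp h θstar) ≤ dKL η (gexp h θ)
      ∧ (dKL η (gexp h θ) = dKL η (gexp h θstar) → gexp h θ = gexp h θstar) := by
  have hk0 : 0 < k := by omega
  intro θ
  have hS := gexp_mem_Simplex hk0 h θstar
  have hcross (φ : Fin p ⊕ Fin k → ℝ) : ∑ i, ∑ ℓ, η i ℓ * Real.log (gexp h φ i ℓ)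
      = ∑ i, ∑ ℓ, gexp h θstar i ℓ * Real.log (gexp h φ i ℓ) := by
    simp only [sum_mul_log_gexp hk0 h hη, sum_mul_log_gexp hk0 h hS, hmatch]
  rw [dKL_of_pos η (gexp_pos hk0 h θstar), dKL_of_pos η (gexp_pos hk0 h θ), hcross, hcross,
    EReal.coe_le_coe_iff, EReal.coe_eq_coe_iff, sub_right_inj]
  exact ⟨sub_le_sub_left (sum_mul_log_le hS (gexp_mem_Simplex hk0 h θ)
      (gexp_pos hk0 h θstar) (gexp_pos hk0 h θ)) _,
    eq_of_sum_mul_log_eq hS (gexp_mem_Simplex hk0 h θ)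
      (gexp_pos hk0 h θstar) (gexp_pos hk0 h θ)⟩
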